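/- arXiv:1112.2471 — 2 statements merged into one kernel-verified Lean document; each statement's English description precedes it below -/
import Mathlib

section
/- If the horizontal and vertical 2×2 transition matrices H₂(B) and V₂(B) are non-degenerated (i.e., every p×p block H_{2;α}, resp. V_{2;α}, has no zero row and no zero column), then Σ(B) is topologically mixing if and only if H_n(B) and V_n(B) are primitive for all n ≥ 2. -/
open scoped Classical

/-- A `2×2` pattern over `p` symbols; first argument is the horizontal
coordinate, second the vertical coordinate. -/
abbrev Pat (p : ℕ) := Fin 2 → Fin 2 → Fin p

/-- The `2×2` block of the configuration `W` with lower-left corner `v`. -/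
def blk {p : ℕ} (W : ℤ × ℤ → Fin p) (v : ℤ × ℤ) : Pat p :=
  fun a b => W (v.1 + (a : ℕ), v.2 + (b : ℕ))

/-- The `2×2` square lattice `Z_{2×2}(v)` with lower-left corner `v`. -/
def sqr (v : ℤ × ℤ) : Set (ℤ × ℤ) :=
  {x | ∃ a b : Fin 2, x = (v.1 + (a : ℕ), v.2 + (b : ℕ))}

/-- `U` is a `B`-admissible pattern on the region `R`: every `2×2` block fully
contained in `R` carries a pattern of `B`. -/
def AdmOn {p : ℕ} (B : Set (Pat p)) (R : Set (ℤ × ℤ)) (U : ℤ × ℤ → Fin p) : Prop :=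
  ∀ v : ℤ × ℤ, sqr v ⊆ R → blk U v ∈ B

/-- `W` is a global `B`-admissible configuration, i.e. `W ∈ Σ(B)`. -/
def Glob {p : ℕ} (B : Set (Pat p)) (W : ℤ × ℤ → Fin p) : Prop :=
  ∀ v : ℤ × ℤ, blk W v ∈ B

/-- The crisscross lattice `Z₊`. -/
def Zplus : Set (ℤ × ℤ) :=
  sqr (0, 0) ∪ sqr (1, 0) ∪ sqr (-1, 0) ∪ sqr (0, 1) ∪ sqr (0, -1)

/-- The rectangular lattice `Z_{m×n}(v)`. -/
def rect (m n : ℕ) (v : ℤ × ℤ) : Set (ℤ × ℤ) :=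
  {x | ∃ a b : ℕ, a < m ∧ b < n ∧ x = (v.1 + a, v.2 + b)}

/-- Euclidean distance between two lattice points of `ℤ²`. -/
noncomputable def eDist (x y : ℤ × ℤ) : ℝ :=
  Real.sqrt (((x.1 - y.1 : ℤ) : ℝ) ^ 2 + ((x.2 - y.2 : ℤ) : ℝ) ^ 2)

/-- `B`-admissibility of the `2×n` horizontal strip whose left column is `c`
and right column is `d`. -/
def HAdm {p : ℕ} (B : Set (Pat p)) (n : ℕ) (c d : Fin n → Fin p) : Prop :=
  ∀ k k' : Fin n, (k' : ℕ) = (k : ℕ) + 1 →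
    (fun a b : Fin 2 => (if a = 0 then c else d) (if b = 0 then k else k')) ∈ B

/-- `B`-admissibility of the `n×2` vertical strip whose bottom row is `r` and
top row is `s`. -/
def VAdm {p : ℕ} (B : Set (Pat p)) (n : ℕ) (r s : Fin n → Fin p) : Prop :=
  ∀ k k' : Fin n, (k' : ℕ) = (k : ℕ) + 1 →
    (fun a b : Fin 2 => (if b = 0 then r else s) (if a = 0 then k else k')) ∈ B

/-- The horizontal transition matrix `H_n(B)`, indexed by columns of height
`n`. -/
noncomputable def Hmat {p : ℕ} (B : Set (Pat p)) (n : ℕ) :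
    Matrix (Fin n → Fin p) (Fin n → Fin p) ℕ :=
  fun c d => if HAdm B n c d then 1 else 0

/-- The vertical transition matrix `V_n(B)`, indexed by rows of width `n`. -/
noncomputable def Vmat {p : ℕ} (B : Set (Pat p)) (n : ℕ) :
    Matrix (Fin n → Fin p) (Fin n → Fin p) ℕ :=
  fun r s => if VAdm B n r s then 1 else 0

/-- A matrix has no zero row and no zero column. -/
def NonCompressible {ι : Type*} (A : Matrix ι ι ℕ) : Prop :=
  (∀ i, ∃ j, A i j ≠ 0) ∧ (∀ j, ∃ i, A i j ≠ 0)

/-- The saturated matrix `E(A)`. -/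
noncomputable def Esat {ι : Type*} [Fintype ι] (A : Matrix ι ι ℕ) : Matrix ι ι ℕ :=
  fun i j => if (∀ k, A i k = 0) ∨ (∀ k, A k j = 0) then 0 else 1

/-- `A` is primitive: some power of `A` (and all higher powers) dominates the
saturated matrix `E(A)` entrywise. -/
def Primitive {ι : Type*} [Fintype ι] [DecidableEq ι] (A : Matrix ι ι ℕ) : Prop :=
  ∃ n₀ : ℕ, 1 ≤ n₀ ∧ ∀ m, n₀ ≤ m → ∀ i j, Esat A i j ≤ (A ^ m) i j

/-- `B` is rectangle-extendable: every `B`-admissible pattern on an `m×n`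
rectangle (`m, n ≥ 2`) extends to a global configuration in `Σ(B)`. -/
def RectExt {p : ℕ} (B : Set (Pat p)) : Prop :=
  ∀ m n : ℕ, 2 ≤ m → 2 ≤ n → ∀ U : ℤ × ℤ → Fin p,
    AdmOn B (rect m n (0, 0)) U →
    ∃ W, Glob B W ∧ ∀ x ∈ rect m n (0, 0), W x = U x

/-- `Σ(B)` is topologically mixing. -/
def Mixing {p : ℕ} (B : Set (Pat p)) : Prop :=
  ∀ R₁ R₂ : Set (ℤ × ℤ), R₁.Finite → R₂.Finite →
    ∃ M : ℝ, ∀ v : ℤ × ℤ,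
      (∀ x ∈ R₁, ∀ y ∈ R₂, M ≤ eDist x (y.1 + v.1, y.2 + v.2)) →
      ∀ W₁ W₂ : ℤ × ℤ → Fin p, Glob B W₁ → Glob B W₂ →
        ∃ W, Glob B W ∧ (∀ x ∈ R₁, W x = W₁ x) ∧
          (∀ y ∈ R₂, W (y.1 + v.1, y.2 + v.2) = W₂ (y.1 + v.1, y.2 + v.2))

/-- The `2×2` pattern with bottom row `(a₀, a₁)` and top row `(b₀, b₁)`. -/
def pat2 {p : ℕ} (a₀ a₁ b₀ b₁ : Fin p) : Pat p :=
  fun a b => if b = 0 then (if a = 0 then a₀ else a₁) else (if a = 0 then b₀ else b₁)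

/-- `H₂(B)` is non-degenerated: each `p×p` block `H_{2;α}` (indexed by a bottom
row `α = (a₀,a₁)`, with inner indices the top rows) has no zero row and no zero
column. -/
def NonDegH {p : ℕ} (B : Set (Pat p)) : Prop :=
  ∀ a₀ a₁ : Fin p,
    (∀ b₀, ∃ b₁, pat2 a₀ a₁ b₀ b₁ ∈ B) ∧ (∀ b₁, ∃ b₀, pat2 a₀ a₁ b₀ b₁ ∈ B)

/-- `V₂(B)` is non-degenerated: each `p×p` block `V_{2;α}` (indexed by a left
column `α = (a₀,a₁)`, with inner indices the right columns) has no zero row and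
no zero column. -/
def NonDegV {p : ℕ} (B : Set (Pat p)) : Prop :=
  ∀ a₀ a₁ : Fin p,
    (∀ b₀, ∃ b₁, (fun a b : Fin 2 =>
        if a = 0 then (if b = 0 then a₀ else a₁) else (if b = 0 then b₀ else b₁)) ∈ B) ∧
    (∀ b₁, ∃ b₀, (fun a b : Fin 2 =>
        if a = 0 then (if b = 0 then a₀ else a₁) else (if b = 0 then b₀ else b₁)) ∈ B)

theorem ext_right {α : Type*} (P : ℤ → α → α → Prop) (Q : ℤ → α → Prop)
    (h : ∀ x u, Q x u → ∃ w, P x u w ∧ Q (x + 1) w) (s : ℤ → α) (b : ℤ) (hb : Q b (s b)) :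
    ∃ s' : ℤ → α, (∀ x, x ≤ b → s' x = s x) ∧
      ∀ x, b ≤ x → P x (s' x) (s' (x + 1)) ∧ Q x (s' x) := by
  choose! F hF using h
  let t : ℕ → α := fun n => Nat.rec (s b) (fun k u => F (b + k) u) n
  have ht0 : t 0 = s b := rfl
  have hts : ∀ k : ℕ, t (k + 1) = F (b + k) (t k) := fun k => rfl
  have hQ : ∀ k : ℕ, Q (b + k) (t k) := by
    intro k
    induction k with
    | zero => simpa [ht0] using hb
    | succ k ih =>
      rw [hts]
      have := (hF _ _ ih).2
      push_cast
      rw [← add_assoc]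
      exact this
  refine ⟨fun x => if x ≤ b then s x else t (x - b).toNat, fun x hx => by simp [hx], ?_⟩
  intro x hx
  have key : ∀ k : ℕ, (if b + k ≤ b then s (b + k) else t (b + k - b).toNat) = t k := by
    intro k
    rcases Nat.eq_zero_or_pos k with rfl | hk
    · simp [ht0]
    · rw [if_neg (by omega)]
      congr 1
      omega
  obtain ⟨k, rfl⟩ : ∃ k : ℕ, x = b + k := ⟨(x - b).toNat, by omega⟩
  have k1 := key k
  have k2 := key (k + 1)
  push_cast at k2
  rw [← add_assoc] at k2
  show P _ (if _ then _ else _) (if _ then _ else _) ∧ Q _ (if _ then _ else _)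
  rw [k1, k2, hts]
  exact ⟨(hF _ _ (hQ k)).1, hQ k⟩

theorem biext {α : Type*} (P : ℤ → α → α → Prop) (hr : ∀ x u, ∃ w, P x u w)
    (hl : ∀ x w, ∃ u, P x u w) (s : ℤ → α) (a b : ℤ) (hab : a ≤ b)
    (hs : ∀ x, a ≤ x → x < b → P x (s x) (s (x + 1))) :
    ∃ s' : ℤ → α, (∀ x, a ≤ x → x ≤ b → s' x = s x) ∧ ∀ x, P x (s' x) (s' (x + 1)) := by
  obtain ⟨s1, h1, h1'⟩ := ext_right P (fun _ _ => True)
    (fun x u _ => by obtain ⟨w, hw⟩ := hr x u; exact ⟨w, hw, trivial⟩) s b trivial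
  obtain ⟨s2, h2, h2'⟩ := ext_right (fun x u w => P (-x - 1) w u) (fun _ _ => True)
    (fun x u _ => by obtain ⟨w, hw⟩ := hl (-x - 1) u; exact ⟨w, hw, trivial⟩)
    (fun x => s1 (-x)) (-a) trivial
  refine ⟨fun x => s2 (-x), fun x hx hx' => ?_, fun x => ?_⟩
  · show s2 (-x) = s x
    rw [h2 _ (by omega)]
    simp [h1 x hx']
  · show P x (s2 (-x)) (s2 (-(x + 1)))
    by_cases hxa : a ≤ x
    · rw [h2 _ (by omega), h2 _ (by omega)]
      simp only [neg_neg]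
      by_cases hxb : b ≤ x
      · exact (h1' x hxb).1
      · rw [h1 _ (by omega), h1 _ (by omega)]
        exact hs x hxa (by omega)
    · have := (h2' (-(x + 1)) (by omega)).1
      have e1 : -(-(x + 1)) - 1 = x := by ring
      have e2 : -(x + 1) + 1 = -x := by ring
      rwa [e1, e2] at this

theorem blk_eq {p : ℕ} (W : ℤ × ℤ → Fin p) (x y : ℤ) :
    blk W (x, y) = pat2 (W (x, y)) (W (x + 1, y)) (W (x, y + 1)) (W (x + 1, y + 1)) := by
  funext a b
  fin_cases a <;> fin_cases b <;> simp [blk, pat2]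

theorem glob_iff {p : ℕ} (B : Set (Pat p)) (W : ℤ × ℤ → Fin p) :
    Glob B W ↔ ∀ x y, pat2 (W (x, y)) (W (x + 1, y)) (W (x, y + 1)) (W (x + 1, y + 1)) ∈ B := by
  constructor
  · intro h x y
    rw [← blk_eq]
    exact h _
  · rintro h ⟨x, y⟩
    rw [blk_eq]
    exact h x y

theorem fill {p : ℕ} (B : Set (Pat p)) (hH : NonDegH B) (S : ℤ × ℤ → Fin p) (y0 a b : ℤ)
    (hab : a ≤ b)
    (hlow : ∀ x y, y + 1 ≤ y0 →
      pat2 (S (x, y)) (S (x + 1, y)) (S (x, y + 1)) (S (x + 1, y + 1)) ∈ B)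
    (hst : ∀ x y, a ≤ x → x < b → y0 ≤ y →
      pat2 (S (x, y)) (S (x + 1, y)) (S (x, y + 1)) (S (x + 1, y + 1)) ∈ B) :
    ∃ W, Glob B W ∧ (∀ x y, y ≤ y0 → W (x, y) = S (x, y)) ∧
      (∀ x y, a ≤ x → x ≤ b → W (x, y) = S (x, y)) := by
  obtain ⟨R, hR, hR'⟩ := ext_right (α := ℤ → Fin p)
    (fun _ r s => ∀ x, pat2 (r x) (r (x + 1)) (s x) (s (x + 1)) ∈ B)
    (fun y r => y0 ≤ y ∧ ∀ x, a ≤ x → x ≤ b → r x = S (x, y))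
    (by
      rintro y r ⟨hy, hr⟩
      obtain ⟨s, hs, hs'⟩ := biext (fun x u w => pat2 (r x) (r (x + 1)) u w ∈ B)
        (fun x u => (hH _ _).1 u) (fun x w => (hH _ _).2 w) (fun x => S (x, y + 1)) a b hab
        (by
          intro x hx hx'
          have := hst x y hx hx' hy
          rwa [← hr x hx hx'.le, ← hr (x + 1) (by omega) (by omega)] at this)
      exact ⟨s, hs', by omega, hs⟩)
    (fun y x => S (x, y)) y0 ⟨le_rfl, fun _ _ _ => rfl⟩
  refine ⟨fun v => R v.2 v.1, (glob_iff _ _).2 ?_, ?_, ?_⟩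
  · intro x y
    by_cases hy : y0 ≤ y
    · exact (hR' y hy).1 x
    · show pat2 (R y x) (R y (x + 1)) (R (y + 1) x) (R (y + 1) (x + 1)) ∈ B
      rw [hR y (by omega), hR (y + 1) (by omega)]
      exact hlow x y (by omega)
  · intro x y hy
    show R y x = _
    rw [hR y hy]
  · intro x y hx hx'
    show R y x = _
    by_cases hy : y0 ≤ y
    · exact (hR' y hy).2.2 x hx hx'
    · rw [hR y (by omega)]

theorem pow_path {ι : Type*} [Fintype ι] [DecidableEq ι] (A : Matrix ι ι ℕ) (m : ℕ) (i j : ι) :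
    (A ^ m) i j ≠ 0 ↔ ∃ f : ℕ → ι, f 0 = i ∧ f m = j ∧ ∀ k, k < m → A (f k) (f (k + 1)) ≠ 0 := by
  induction m generalizing j with
  | zero =>
    rw [pow_zero, Matrix.one_apply]
    constructor
    · intro h
      have : i = j := by
        by_contra hh
        simp [hh] at h
      exact ⟨fun _ => i, rfl, this, by simp⟩
    · rintro ⟨f, h1, h2, -⟩
      simp [← h1, ← h2]
  | succ m ih =>
    rw [pow_succ, Matrix.mul_apply]
    constructor
    · intro h
      obtain ⟨k, -, hk⟩ := Finset.exists_ne_zero_of_sum_ne_zero h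
      obtain ⟨f, h1, h2, h3⟩ := (ih k).1 (left_ne_zero_of_mul hk)
      refine ⟨fun t => if t ≤ m then f t else j, by simp [h1], by simp, ?_⟩
      intro t ht
      show A (if _ then _ else _) (if _ then _ else _) ≠ 0
      rw [if_pos (by omega)]
      by_cases htm : t + 1 ≤ m
      · rw [if_pos htm]
        exact h3 t (by omega)
      · rw [if_neg htm]
        have : t = m := by omega
        rw [this, h2]
        exact right_ne_zero_of_mul hk
    · rintro ⟨f, h1, h2, h3⟩ h
      have h0 := (Finset.sum_eq_zero_iff.1 h) (f m) (Finset.mem_univ _)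
      rcases mul_eq_zero.1 h0 with h0 | h0
      · exact (ih (f m)).2 ⟨f, h1, rfl, fun k hk => h3 k (by omega)⟩ h0
      · rw [← h2] at h0
        exact h3 m (by omega) h0

theorem vadm_iff {p : ℕ} (B : Set (Pat p)) (n : ℕ) (r s : Fin n → Fin p) :
    Vmat B n r s ≠ 0 ↔ ∀ k k' : Fin n, (k' : ℕ) = (k : ℕ) + 1 →
      pat2 (r k) (r k') (s k) (s k') ∈ B := by
  have : ∀ k k' : Fin n, (fun a b : Fin 2 => (if b = 0 then r else s) (if a = 0 then k else k'))
      = pat2 (r k) (r k') (s k) (s k') := by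
    intro k k'
    funext a b
    fin_cases a <;> fin_cases b <;> simp [pat2]
  simp only [Vmat, VAdm, this]
  split_ifs with h
  · exact ⟨fun _ => h, fun _ => one_ne_zero⟩
  · exact ⟨fun h' => absurd rfl h', fun h' => absurd h' h⟩

theorem vadm_of_glob {p : ℕ} (B : Set (Pat p)) (W : ℤ × ℤ → Fin p) (hW : Glob B W) (n : ℕ)
    (x y : ℤ) :
    Vmat B n (fun k => W (x + (k : ℕ), y)) (fun k => W (x + (k : ℕ), y + 1)) ≠ 0 := by
  rw [vadm_iff]
  intro k k' h
  have := (glob_iff _ _).1 hW (x + (k : ℕ)) y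
  simp only [h]
  push_cast
  rwa [← add_assoc]

theorem vert {p : ℕ} (B : Set (Pat p)) (hH : NonDegH B) (n : ℕ) (hn : 1 ≤ n)
    (hP : Primitive (Vmat B n)) :
    ∃ T : ℕ, ∀ x0 y0 y1 : ℤ, y0 + T ≤ y1 → ∀ W1 W2, Glob B W1 → Glob B W2 →
      ∃ W, Glob B W ∧ (∀ x y, y ≤ y0 → W (x, y) = W1 (x, y)) ∧
        (∀ x y, x0 ≤ x → x < x0 + n → y1 ≤ y → W (x, y) = W2 (x, y)) := by
  obtain ⟨T, hT1, hT⟩ := hP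
  refine ⟨T, fun x0 y0 y1 hy W1 W2 hW1 hW2 => ?_⟩
  obtain ⟨m, rfl⟩ : ∃ m : ℕ, y1 = y0 + m := ⟨(y1 - y0).toNat, by omega⟩
  have hE := hT m (by omega) (fun k => W1 (x0 + (k : ℕ), y0)) (fun k => W2 (x0 + (k : ℕ), y0 + m))
  have hpos : (Vmat B n ^ m) (fun k => W1 (x0 + (k : ℕ), y0))
      (fun k => W2 (x0 + (k : ℕ), y0 + m)) ≠ 0 := by
    unfold Esat at hE
    rw [if_neg] at hE
    · omega
    · rintro (h | h)
      · exact vadm_of_glob B W1 hW1 n x0 y0 (h _)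
      · have := vadm_of_glob B W2 hW2 n x0 (y0 + m - 1)
        rw [sub_add_cancel] at this
        exact this (h _)
  obtain ⟨f, hf0, hfm, hf⟩ := (pow_path _ _ _ _).1 hpos
  let g : ℕ → ℤ → Fin p := fun t x => f t ⟨min (x - x0).toNat (n - 1), by omega⟩
  have hg : ∀ t x (k : Fin n), x = x0 + (k : ℕ) → g t x = f t k := by
    intro t x k hk
    simp only [g]
    congr 1
    apply Fin.ext
    have := k.2
    simp only
    omega
  let S : ℤ × ℤ → Fin p := fun v =>
    if v.2 ≤ y0 then W1 v else if y0 + m ≤ v.2 then W2 v else g (v.2 - y0).toNat v.1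
  have hS1 : ∀ x y, y ≤ y0 → S (x, y) = W1 (x, y) := by
    intro x y h
    simp only [S]
    rw [if_pos h]
  have hS2 : ∀ x y, y0 + m ≤ y → S (x, y) = W2 (x, y) := by
    intro x y h
    simp only [S]
    rw [if_neg (by omega), if_pos h]
  have hS3 : ∀ (t : ℕ) (k : Fin n), t ≤ m → S (x0 + (k : ℕ), y0 + t) = f t k := by
    intro t k ht
    rcases Nat.eq_zero_or_pos t with rfl | h0
    · rw [hS1 _ _ (by simp), hf0]
      simp
    rcases Nat.eq_or_lt_of_le ht with rfl | hm
    · rw [hS2 _ _ le_rfl, hfm]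
    · simp only [S]
      rw [if_neg (by omega), if_neg (by omega), hg _ _ k rfl]
      congr 1
      omega
  obtain ⟨W, hW, h1, h2⟩ := fill B hH S y0 x0 (x0 + (n - 1 : ℕ)) (by omega)
    (by
      intro x y h
      rw [hS1 _ _ (by omega), hS1 _ _ (by omega), hS1 _ _ (by omega), hS1 _ _ (by omega)]
      exact (glob_iff _ _).1 hW1 x y)
    (by
      intro x y hx hx' h
      by_cases hym : y0 + m ≤ y
      · rw [hS2 _ _ (by omega), hS2 _ _ (by omega), hS2 _ _ (by omega), hS2 _ _ (by omega)]
        exact (glob_iff _ _).1 hW2 x y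
      · obtain ⟨t, rfl⟩ : ∃ t : ℕ, y = y0 + t := ⟨(y - y0).toNat, by omega⟩
        obtain ⟨k, rfl⟩ : ∃ k : ℕ, x = x0 + k := ⟨(x - x0).toNat, by omega⟩
        have e1 := hS3 t ⟨k, by omega⟩ (by omega)
        have e2 := hS3 t ⟨k + 1, by omega⟩ (by omega)
        have e3 := hS3 (t + 1) ⟨k, by omega⟩ (by omega)
        have e4 := hS3 (t + 1) ⟨k + 1, by omega⟩ (by omega)
        push_cast at e1 e2 e3 e4
        simp only [← add_assoc] at e1 e2 e3 e4
        rw [e1, e2, e3, e4]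
        exact (vadm_iff _ _ _ _).1 (hf t (by omega)) _ _ rfl)
  refine ⟨W, hW, fun x y h => by rw [h1 x y h, hS1 x y h], fun x y hx hx' h => ?_⟩
  rw [h2 x y hx (by omega), hS2 x y h]

def trB {p : ℕ} (B : Set (Pat p)) : Set (Pat p) := {P | (fun a b => P b a) ∈ B}

theorem glob_tr {p : ℕ} (B : Set (Pat p)) (W : ℤ × ℤ → Fin p) :
    Glob (trB B) W ↔ Glob B (fun v => W v.swap) :=
  ⟨fun h v => h v.swap, fun h v => h v.swap⟩

theorem nonDegH_tr {p : ℕ} (B : Set (Pat p)) (hV : NonDegV B) : NonDegH (trB B) := hV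

theorem nonDegV_tr {p : ℕ} (B : Set (Pat p)) (hH : NonDegH B) : NonDegV (trB B) := hH

theorem vmat_tr {p : ℕ} (B : Set (Pat p)) (n : ℕ) : Vmat (trB B) n = Hmat B n := rfl

theorem finite_bound (R : Set (ℤ × ℤ)) (hR : R.Finite) :
    ∃ N : ℕ, ∀ x ∈ R, |x.1| ≤ N ∧ |x.2| ≤ N := by
  refine ⟨hR.toFinset.sup (fun x => x.1.natAbs + x.2.natAbs), fun x hx => ?_⟩
  have := Finset.le_sup (f := fun x : ℤ × ℤ => x.1.natAbs + x.2.natAbs) (hR.mem_toFinset.2 hx)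
  rw [Int.abs_eq_natAbs, Int.abs_eq_natAbs]
  omega

theorem mixV {p : ℕ} (B : Set (Pat p)) (hH : NonDegH B) (N : ℕ) (hN : 1 ≤ N)
    (hP : Primitive (Vmat B (2 * N + 1))) :
    ∃ T : ℕ, ∀ v : ℤ × ℤ, (T : ℤ) ≤ |v.2| → ∀ W₁ W₂ : ℤ × ℤ → Fin p, Glob B W₁ → Glob B W₂ →
      ∃ W, Glob B W ∧ (∀ x : ℤ × ℤ, |x.1| ≤ N → |x.2| ≤ N → W x = W₁ x) ∧
        (∀ y : ℤ × ℤ, |y.1| ≤ N → |y.2| ≤ N →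
          W (y.1 + v.1, y.2 + v.2) = W₂ (y.1 + v.1, y.2 + v.2)) := by
  obtain ⟨T, hT⟩ := vert B hH (2 * N + 1) (by omega) hP
  refine ⟨2 * N + T, fun v hv W1 W2 h1 h2 => ?_⟩
  push_cast at hv
  rcases le_or_gt 0 v.2 with h0 | h0
  · rw [abs_of_nonneg h0] at hv
    obtain ⟨W, hW, ha, hb⟩ := hT (v.1 - N) N (v.2 - N) (by omega) W1 W2 h1 h2
    refine ⟨W, hW, ?_, ?_⟩
    · rintro ⟨x, y⟩ hx hy
      rw [abs_le] at hx hy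
      exact ha _ _ hy.2
    · rintro ⟨x, y⟩ hx hy
      rw [abs_le] at hx hy
      simp only at hx hy
      exact hb _ _ (by omega) (by push_cast; omega) (by omega)
  · rw [abs_of_neg h0] at hv
    obtain ⟨W, hW, ha, hb⟩ := hT (-N) (v.2 + N) (-N) (by omega) W2 W1 h2 h1
    refine ⟨W, hW, ?_, ?_⟩
    · rintro ⟨x, y⟩ hx hy
      rw [abs_le] at hx hy
      simp only at hx hy
      exact hb _ _ (by omega) (by push_cast; omega) (by omega)
    · rintro ⟨x, y⟩ hx hy
      rw [abs_le] at hx hy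
      simp only at hx hy
      exact ha _ _ (by simp only; omega)

theorem mixH {p : ℕ} (B : Set (Pat p)) (hV : NonDegV B) (N : ℕ) (hN : 1 ≤ N)
    (hP : Primitive (Hmat B (2 * N + 1))) :
    ∃ T : ℕ, ∀ v : ℤ × ℤ, (T : ℤ) ≤ |v.1| → ∀ W₁ W₂ : ℤ × ℤ → Fin p, Glob B W₁ → Glob B W₂ →
      ∃ W, Glob B W ∧ (∀ x : ℤ × ℤ, |x.1| ≤ N → |x.2| ≤ N → W x = W₁ x) ∧
        (∀ y : ℤ × ℤ, |y.1| ≤ N → |y.2| ≤ N →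
          W (y.1 + v.1, y.2 + v.2) = W₂ (y.1 + v.1, y.2 + v.2)) := by
  obtain ⟨T, hT⟩ := mixV (trB B) (nonDegH_tr B hV) N hN (by rw [vmat_tr]; exact hP)
  refine ⟨T, fun v hv W1 W2 h1 h2 => ?_⟩
  obtain ⟨W, hW, ha, hb⟩ := hT v.swap hv (fun u => W1 u.swap) (fun u => W2 u.swap)
    ((glob_tr _ _).2 h1) ((glob_tr _ _).2 h2)
  exact ⟨fun u => W u.swap, (glob_tr _ _).1 hW, fun x hx hy => ha x.swap hy hx,
    fun y hx hy => hb y.swap hy hx⟩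

theorem eDist_le (x y : ℤ × ℤ) : eDist x y ≤ ((|x.1 - y.1| + |x.2 - y.2| : ℤ) : ℝ) := by
  unfold eDist
  apply Real.sqrt_le_iff.2
  push_cast
  refine ⟨by positivity, ?_⟩
  rw [← sq_abs ((x.1 : ℝ) - y.1), ← sq_abs ((x.2 : ℝ) - y.2)]
  nlinarith [mul_nonneg (abs_nonneg ((x.1 : ℝ) - y.1)) (abs_nonneg ((x.2 : ℝ) - y.2))]

theorem le_eDist_h (x y : ℤ × ℤ) : ((|x.1 - y.1| : ℤ) : ℝ) ≤ eDist x y := by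
  unfold eDist
  apply Real.le_sqrt_of_sq_le
  push_cast
  rw [sq_abs]
  nlinarith [sq_nonneg ((x.2 : ℝ) - y.2)]

theorem prim_mixing {p : ℕ} (B : Set (Pat p)) (hH : NonDegH B) (hV : NonDegV B)
    (h : ∀ n : ℕ, 2 ≤ n → Primitive (Hmat B n) ∧ Primitive (Vmat B n)) : Mixing B := by
  intro R1 R2 hR1 hR2
  obtain ⟨N1, hN1⟩ := finite_bound R1 hR1
  obtain ⟨N2, hN2⟩ := finite_bound R2 hR2
  let N := N1 + N2 + 1
  obtain ⟨T1, hT1⟩ := mixH B hV N (by omega) (h _ (by omega)).1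
  obtain ⟨T2, hT2⟩ := mixV B hH N (by omega) (h _ (by omega)).2
  have hb1 : ∀ x ∈ R1, |x.1| ≤ N ∧ |x.2| ≤ N := fun x hx => by have := hN1 x hx; omega
  have hb2 : ∀ x ∈ R2, |x.1| ≤ N ∧ |x.2| ≤ N := fun x hx => by have := hN2 x hx; omega
  refine ⟨((4 * N + T1 + T2 + 1 : ℤ) : ℝ), fun v hv W1 W2 g1 g2 => ?_⟩
  rcases R1.eq_empty_or_nonempty with rfl | ⟨x, hx⟩
  · exact ⟨W2, g2, by simp, fun _ _ => rfl⟩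
  rcases R2.eq_empty_or_nonempty with rfl | ⟨y, hy⟩
  · exact ⟨W1, g1, fun _ _ => rfl, by simp⟩
  have hd : (4 * N + T1 + T2 + 1 : ℤ) ≤ |x.1 - (y.1 + v.1)| + |x.2 - (y.2 + v.2)| := by
    exact_mod_cast (hv x hx y hy).trans (eDist_le _ _)
  have hx' := hb1 x hx
  have hy' := hb2 y hy
  have t1 : |x.1 - (y.1 + v.1)| ≤ |x.1| + (|y.1| + |v.1|) :=
    (abs_sub _ _).trans (by gcongr; exact abs_add_le _ _)
  have t2 : |x.2 - (y.2 + v.2)| ≤ |x.2| + (|y.2| + |v.2|) :=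
    (abs_sub _ _).trans (by gcongr; exact abs_add_le _ _)
  rcases le_or_gt (T1 : ℤ) |v.1| with hc | hc
  · obtain ⟨W, hW, ha, hb⟩ := hT1 v hc W1 W2 g1 g2
    exact ⟨W, hW, fun x hx => ha x (hb1 x hx).1 (hb1 x hx).2,
      fun x hx => hb x (hb2 x hx).1 (hb2 x hx).2⟩
  · obtain ⟨W, hW, ha, hb⟩ := hT2 v (by omega) W1 W2 g1 g2
    exact ⟨W, hW, fun x hx => ha x (hb1 x hx).1 (hb1 x hx).2,
      fun x hx => hb x (hb2 x hx).1 (hb2 x hx).2⟩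

theorem pat2_eq {p : ℕ} (a b c d : Fin p) : (fun i j : Fin 2 =>
        if i = 0 then (if j = 0 then a else c) else (if j = 0 then b else d)) = pat2 a b c d := by
  funext i j
  fin_cases i <;> fin_cases j <;> simp [pat2]

theorem exists_glob {p : ℕ} (hp : 2 ≤ p) (B : Set (Pat p)) (hH : NonDegH B) (hV : NonDegV B) :
    ∃ W, Glob B W := by
  obtain ⟨s, -, hs⟩ := biext (α := Fin p × Fin p)
    (fun _ u w => u.2 = w.1 ∧ pat2 u.2 w.2 u.1 w.1 ∈ B)
    (by
      rintro - ⟨a, b⟩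
      obtain ⟨c, hc⟩ := (hV b a).2 b
      rw [pat2_eq] at hc
      exact ⟨(b, c), rfl, hc⟩)
    (by
      rintro - ⟨a, b⟩
      obtain ⟨c, hc⟩ := (hH a b).2 a
      exact ⟨(c, a), rfl, hc⟩)
    (fun _ => (⟨0, by omega⟩, ⟨0, by omega⟩)) 0 0 le_rfl (by intro x h1 h2; omega)
  refine ⟨fun v => (s (v.1 - v.2)).1, (glob_iff _ _).2 fun x y => ?_⟩
  have h1 := hs (x - y - 1)
  have h2 := hs (x - y)
  rw [sub_add_cancel] at h1
  have e1 : x - (y + 1) = x - y - 1 := by ring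
  have e2 : x + 1 - y = x - y + 1 := by ring
  have e3 : x + 1 - (y + 1) = x - y := by ring
  simp only [e1, e2, e3]
  rw [← h2.1, ← h1.1]
  have := h1.2
  rwa [← h1.1] at this

theorem exists_col {p : ℕ} (hp : 2 ≤ p) (B : Set (Pat p)) (hH : NonDegH B) (hV : NonDegV B)
    (x0 : ℤ) (n : ℕ) (c : Fin n → Fin p) :
    ∃ W, Glob B W ∧ ∀ k : Fin n, W (x0, (k : ℕ)) = c k := by
  obtain ⟨W0, h0⟩ := exists_glob hp B hH hV
  let S : ℤ × ℤ → Fin p := fun v =>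
    if h : 0 ≤ v.2 ∧ v.2.toNat < n then c ⟨v.2.toNat, h.2⟩ else W0 v
  obtain ⟨W, hW, -, h2⟩ := fill B hH S (-1) x0 x0 le_rfl
    (by
      intro x y hy
      have : ∀ x' y' : ℤ, y' < 0 → S (x', y') = W0 (x', y') := by
        intro x' y' h
        simp only [S]
        rw [dif_neg (by omega)]
      rw [this _ _ (by omega), this _ _ (by omega), this _ _ (by omega), this _ _ (by omega)]
      exact (glob_iff _ _).1 h0 x y)
    (by intro x y h h'; omega)
  refine ⟨W, hW, fun k => ?_⟩
  rw [h2 _ _ le_rfl le_rfl]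
  simp [S]

theorem mixing_primH {p : ℕ} (hp : 2 ≤ p) (B : Set (Pat p)) (hH : NonDegH B) (hV : NonDegV B)
    (hM : Mixing B) (n : ℕ) : Primitive (Hmat B n) := by
  let R : Set (ℤ × ℤ) := Set.range (fun k : Fin n => ((0 : ℤ), ((k : ℕ) : ℤ)))
  obtain ⟨M, hM⟩ := hM R R (Set.finite_range _) (Set.finite_range _)
  refine ⟨⌈M⌉₊ + 1, by omega, fun m hm i j => ?_⟩
  have hE : Esat (Hmat B n) i j ≤ 1 := by
    unfold Esat
    split_ifs <;> simp
  suffices h : (Hmat B n ^ m) i j ≠ 0 by omega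
  obtain ⟨W1, g1, h1⟩ := exists_col hp B hH hV 0 n i
  obtain ⟨W2, g2, h2⟩ := exists_col hp B hH hV m n j
  obtain ⟨W, hW, ha, hb⟩ := hM ((m : ℤ), 0) (by
    rintro _ ⟨k, rfl⟩ _ ⟨k', rfl⟩
    refine le_trans ?_ (le_eDist_h _ _)
    have h1 : M ≤ m := (Nat.le_ceil M).trans (by exact_mod_cast (by omega : ⌈M⌉₊ ≤ m))
    simpa using h1) W1 W2 g1 g2
  rw [pow_path]
  refine ⟨fun t k => W ((t : ℤ), ((k : ℕ) : ℤ)), ?_, ?_, ?_⟩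
  · funext k
    rw [← h1 k, ← ha _ ⟨k, rfl⟩]
    simp
  · funext k
    have := hb _ ⟨k, rfl⟩
    simp only [zero_add, add_zero] at this
    rw [← h2 k, ← this]
  · intro t _
    have := vadm_of_glob (trB B) (fun v => W v.swap) ((glob_tr _ _).2 hW) n 0 t
    rw [vmat_tr] at this
    simpa using this

theorem mixing_tr {p : ℕ} (B : Set (Pat p)) (hM : Mixing B) : Mixing (trB B) := by
  intro R1 R2 h1 h2
  obtain ⟨M, hM⟩ := hM (Prod.swap '' R1) (Prod.swap '' R2) (h1.image _) (h2.image _)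
  refine ⟨M, fun v hv W1 W2 g1 g2 => ?_⟩
  obtain ⟨W, hW, ha, hb⟩ := hM v.swap (by
    rintro _ ⟨x, hx, rfl⟩ _ ⟨y, hy, rfl⟩
    have := hv x hx y hy
    unfold eDist at this ⊢
    rw [add_comm] at this
    exact this) _ _ ((glob_tr _ _).1 g1) ((glob_tr _ _).1 g2)
  exact ⟨fun u => W u.swap, (glob_tr _ _).2 hW, fun x hx => ha _ ⟨x, hx, rfl⟩,
    fun y hy => hb _ ⟨y, hy, rfl⟩⟩

/-- If `H₂(B)` and `V₂(B)` are non-degenerated, then `Σ(B)` is topologically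
mixing if and only if `H_n(B)` and `V_n(B)` are primitive for all `n ≥ 2`. -/
theorem mixing_iff_primitive_of_nonDeg {p : ℕ} (hp : 2 ≤ p) (B : Set (Pat p))
    (hH : NonDegH B) (hV : NonDegV B) :
    (∀ n : ℕ, 2 ≤ n → Primitive (Hmat B n) ∧ Primitive (Vmat B n)) ↔ Mixing B := by
  refine ⟨prim_mixing B hH hV, fun hM n _ => ⟨mixing_primH hp B hH hV hM n, ?_⟩⟩
  exact mixing_primH hp (trB B) (nonDegH_tr B hV) (nonDegV_tr B hH) (mixing_tr B hM) n
end

section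
/- The six-vertex edge-coloring model, with edges of Z² colored in {0,1} (colors interpreted as arrow directions) and the local rule that at each vertex, among the four incident edges, exactly two arrows point inward (equivalently, the allowed local configurations are the six patterns B_{e;6}), yields a shift that is topologically mixing. -/
/-- An edge of the lattice `ℤ²`: `(v, true)` is the horizontal edge from `v`
to `v + (1,0)`, and `(v, false)` is the vertical edge from `v` to `v + (0,1)`. -/
abbrev Edge := (ℤ × ℤ) × Bool

/-- The two endpoints of an edge. -/
def edgeEnds (e : Edge) : Set (ℤ × ℤ) :=
  {e.1, if e.2 then (e.1.1 + 1, e.1.2) else (e.1.1, e.1.2 + 1)}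

/-- Eight-vertex admissibility: at every vertex the sum of the colors of the
four incident edges is even. -/
def Adm8 (W : Edge → ZMod 2) : Prop :=
  ∀ v : ℤ × ℤ,
    W ((v.1 - 1, v.2), true) + W ((v.1, v.2 - 1), false) + W (v, true) + W (v, false) = 0

/-- Six-vertex (ice-type) admissibility: colors are arrow directions
(`1` = rightward/upward), and at every vertex exactly two of the four incident
arrows point inward; equivalently, `left + bottom = right + top`. -/
def Adm6 (W : Edge → Fin 2) : Prop :=
  ∀ v : ℤ × ℤ,
    (W ((v.1 - 1, v.2), true) : ℕ) + (W ((v.1, v.2 - 1), false) : ℕ) =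
      (W (v, true) : ℕ) + (W (v, false) : ℕ)

/-- Translation of an edge by a vector `v`. -/
def edgeShift (v : ℤ × ℤ) (e : Edge) : Edge := ((e.1.1 + v.1, e.1.2 + v.2), e.2)

def sv_d (x y : ℤ × ℤ) : ℤ := |x.1 - y.1| + |x.2 - y.2|

def sv_ht (h : ℤ × ℤ → ℤ) : Prop :=
  ∀ x y : ℤ, (h (x, y) - h (x, y - 1) = 1 ∨ h (x, y) - h (x, y - 1) = -1) ∧
    (h (x, y) - h (x - 1, y) = 1 ∨ h (x, y) - h (x - 1, y) = -1)

theorem sv_prim (g : ℤ → ℤ) : ∃ G : ℤ → ℤ, G 0 = 0 ∧ ∀ n, G n - G (n - 1) = g n := by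
  refine ⟨fun n => ∑ i ∈ Finset.Ioc 0 n, g i - ∑ i ∈ Finset.Ioc n 0, g i, by simp, ?_⟩
  intro n
  rcases le_or_gt n 0 with h | h
  · have e1 : Finset.Ioc 0 n = ∅ := Finset.Ioc_eq_empty (by omega)
    have e2 : Finset.Ioc 0 (n - 1) = ∅ := Finset.Ioc_eq_empty (by omega)
    have e3 : Finset.Ioc (n - 1) 0 = insert n (Finset.Ioc n 0) := by
      ext i; simp only [Finset.mem_Ioc, Finset.mem_insert]; omega
    simp only [e1, e2, e3]
    rw [Finset.sum_insert (by simp)]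
    simp
  · have e1 : Finset.Ioc n 0 = ∅ := Finset.Ioc_eq_empty (by omega)
    have e2 : Finset.Ioc (n - 1) 0 = ∅ := Finset.Ioc_eq_empty (by omega)
    have e3 : Finset.Ioc 0 n = insert n (Finset.Ioc 0 (n - 1)) := by
      ext i; simp only [Finset.mem_Ioc, Finset.mem_insert]; omega
    simp only [e1, e2, e3]
    rw [Finset.sum_insert (by simp)]
    simp

theorem sv_const (g : ℤ → ℤ) (hg : ∀ n, g n = g (n - 1)) (n : ℤ) : g n = g 0 := by
  induction n using Int.induction_on with
  | zero => rfl
  | succ i ih => rw [hg, ← ih]; congr 1; ring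
  | pred i ih => rw [← ih, hg (-(i : ℤ))]

theorem sv_lip1 (g : ℤ → ℤ) (hg : ∀ n, |g n - g (n - 1)| ≤ 1) (m n : ℤ) :
    |g m - g n| ≤ |m - n| := by
  have key : ∀ (k : ℕ) (n : ℤ), |g (n + k) - g n| ≤ k := by
    intro k n
    induction k with
    | zero => simp
    | succ k ih =>
      have := hg (n + (k + 1 : ℕ))
      have e : n + ((k + 1 : ℕ) : ℤ) - 1 = n + k := by push_cast; ring
      rw [e] at this
      push_cast at *
      rw [abs_le] at *
      omega
  rcases le_total n m with h | h
  · have := key (m - n).toNat n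
    have e : ((m - n).toNat : ℤ) = m - n := Int.toNat_of_nonneg (by omega)
    rw [e, add_sub_cancel] at this
    rwa [abs_of_nonneg (show 0 ≤ m - n by omega)]
  · have := key (n - m).toNat m
    have e : ((n - m).toNat : ℤ) = n - m := Int.toNat_of_nonneg (by omega)
    rw [e, add_sub_cancel] at this
    rw [abs_sub_comm, abs_sub_comm m n]
    rwa [abs_of_nonneg (show 0 ≤ n - m by omega)]

theorem sv_lip {h : ℤ × ℤ → ℤ} (hh : sv_ht h) (p q : ℤ × ℤ) : |h p - h q| ≤ sv_d p q := by
  obtain ⟨a, b⟩ := p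
  obtain ⟨c, d⟩ := q
  have h1 := sv_lip1 (fun n => h (n, b)) (fun n => by
    rcases (hh n b).2 with e | e <;> simp [e]) a c
  have h2 := sv_lip1 (fun n => h (c, n)) (fun n => by
    rcases (hh c n).1 with e | e <;> simp [e]) b d
  have := abs_sub_le (h (a, b)) (h (c, b)) (h (c, d))
  simp only [sv_d] at *
  linarith

theorem sv_par {h : ℤ × ℤ → ℤ} (hh : sv_ht h) (p q : ℤ × ℤ) (hp : (h p - p.1 - p.2) % 2 = 0) :
    (h q - q.1 - q.2) % 2 = 0 := by
  have all : ∀ a b : ℤ, (h (a, b) - a - b) % 2 = (h (0, 0)) % 2 := by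
    intro a b
    have h1 := sv_const (fun n => (h (n, b) - n - b) % 2) (fun n => by
      rcases (hh n b).2 with e | e <;> (try dsimp only) <;> omega) a
    have h2 := sv_const (fun n => (h (0, n) - 0 - n) % 2) (fun n => by
      rcases (hh 0 n).1 with e | e <;> (try dsimp only) <;> omega) b
    try dsimp only at h1 h2
    rw [h1, h2]; simp
  have := all p.1 p.2
  have := all q.1 q.2
  simp only [Prod.mk.eta] at *
  omega

theorem sv_height (W : Edge → Fin 2) (hW : Adm6 W) (p : ℤ × ℤ) :
    ∃ h, sv_ht h ∧ h p = (p.1 + p.2) % 2 ∧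
      (∀ x y, h (x, y) - h (x, y - 1) = 2 * (W ((x, y), true) : ℕ) - 1) ∧
      (∀ x y, h (x, y) - h (x - 1, y) = 1 - 2 * (W ((x, y), false) : ℕ)) := by
  choose B hB0 hB using fun x : ℤ => sv_prim (fun y => 2 * ((W ((x, y), true) : ℕ) : ℤ) - 1)
  obtain ⟨A, -, hA⟩ := sv_prim (fun x => 1 - 2 * ((W ((x, 0), false) : ℕ) : ℤ))
  let k : ℤ × ℤ → ℤ := fun q => A q.1 + B q.1 q.2
  have v : ∀ x y, k (x, y) - k (x, y - 1) = 2 * (W ((x, y), true) : ℕ) - 1 := by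
    intro x y
    have := hB x y
    simp only [k] at *
    omega
  have w : ∀ x y, k (x, y) - k (x - 1, y) = 1 - 2 * (W ((x, y), false) : ℕ) := by
    intro x y
    have := sv_const (fun y => k (x, y) - k (x - 1, y) - (1 - 2 * ((W ((x, y), false) : ℕ) : ℤ)))
      (fun n => by
        have h1 := hW (x, n)
        have h2 := v x n
        have h3 := v (x - 1) n
        try dsimp only at *
        omega) y
    try dsimp only at this
    have h0 : k (x, 0) - k (x - 1, 0) = 1 - 2 * ((W ((x, 0), false) : ℕ) : ℤ) := by
      have := hA x
      simp only [k, hB0]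
      omega
    omega
  refine ⟨fun q => k q - k p + (p.1 + p.2) % 2, ?_, by simp, ?_, ?_⟩
  · intro x y
    have h1 := v x y
    have h2 := w x y
    have := (W ((x, y), true)).isLt
    have := (W ((x, y), false)).isLt
    try dsimp only
    omega
  · intro x y
    have h1 := v x y
    try dsimp only
    omega
  · intro x y
    have h1 := w x y
    try dsimp only
    omega

theorem sv_ext (S : Set (ℤ × ℤ)) (hS : S.Nonempty) (f : ℤ × ℤ → ℤ)
    (hl : ∀ s ∈ S, ∀ t ∈ S, f s - f t ≤ sv_d s t)
    (hp : ∀ s ∈ S, (f s - s.1 - s.2) % 2 = 0) :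
    ∃ h, sv_ht h ∧ ∀ s ∈ S, h s = f s := by
  obtain ⟨s0, hs0⟩ := hS
  have tri : ∀ a b c, sv_d a c ≤ sv_d a b + sv_d b c := by
    intro a b c
    have := abs_sub_le a.1 b.1 c.1
    have := abs_sub_le a.2 b.2 c.2
    simp only [sv_d]; omega
  have symm : ∀ a b, sv_d a b = sv_d b a := by
    intro a b
    simp only [sv_d, abs_sub_comm]
  have mn : ∀ x, ∃ m, (∃ s ∈ S, m = f s + sv_d x s) ∧ ∀ s ∈ S, m ≤ f s + sv_d x s := by
    intro x
    obtain ⟨m, h1, h2⟩ := Int.exists_least_of_bdd (P := fun m => ∃ s ∈ S, m = f s + sv_d x s)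
      ⟨f s0 - sv_d x s0, by
        rintro _ ⟨s, hs, rfl⟩
        have := hl s0 hs0 s hs
        have := tri s0 x s
        have := symm s0 x
        omega⟩ ⟨_, s0, hs0, rfl⟩
    exact ⟨m, h1, fun s hs => h2 _ ⟨s, hs, rfl⟩⟩
  choose h h1 h2 using mn
  have le : ∀ x y, h x ≤ h y + sv_d x y := by
    intro x y
    obtain ⟨s, hs, e⟩ := h1 y
    have := h2 x s hs
    have := tri x y s
    omega
  have par : ∀ x : ℤ × ℤ, (h x - x.1 - x.2) % 2 = 0 := by
    intro x
    obtain ⟨s, hs, e⟩ := h1 x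
    have := hp s hs
    rw [e]
    simp only [sv_d]
    rcases abs_cases (x.1 - s.1) with ⟨a, _⟩ | ⟨a, _⟩ <;>
    rcases abs_cases (x.2 - s.2) with ⟨b, _⟩ | ⟨b, _⟩ <;> rw [a, b] <;> omega
  refine ⟨h, ?_, ?_⟩
  · intro x y
    have p1 := par (x, y)
    have p2 := par (x, y - 1)
    have p3 := par (x - 1, y)
    have l1 := le (x, y) (x, y - 1)
    have l2 := le (x, y - 1) (x, y)
    have l3 := le (x, y) (x - 1, y)
    have l4 := le (x - 1, y) (x, y)
    simp [sv_d] at *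
    omega
  · intro s hs
    obtain ⟨t, ht, e⟩ := h1 s
    have := h2 s s hs
    have := hl s hs t ht
    simp [sv_d] at *
    omega

theorem sv_bdd (E : Set Edge) (hE : E.Finite) : ∃ R : ℤ, ∀ e ∈ E, |e.1.1| + |e.1.2| ≤ R := by
  obtain ⟨R, hR⟩ := (hE.image (fun e : Edge => |e.1.1| + |e.1.2|)).bddAbove
  exact ⟨R, fun e he => hR ⟨e, he, rfl⟩⟩

def sv_W (h : ℤ × ℤ → ℤ) : Edge → Fin 2 := fun e =>
  if e.2 = true then (if h e.1 - h (e.1.1, e.1.2 - 1) = 1 then 1 else 0)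
  else (if h e.1 - h (e.1.1 - 1, e.1.2) = 1 then 0 else 1)

theorem sv_W_adm {h : ℤ × ℤ → ℤ} (hh : sv_ht h) : Adm6 (sv_W h) := by
  rintro ⟨x, y⟩
  have a := hh x y
  have b := (hh (x - 1) y).1
  have c := (hh x (y - 1)).2
  simp only [sv_W]
  simp only [if_true, Bool.false_eq_true, if_false]
  split_ifs <;> simp <;> omega

theorem sv_W_eq {h k : ℤ × ℤ → ℤ} {W : Edge → Fin 2}
    (k1 : ∀ x y, k (x, y) - k (x, y - 1) = 2 * (W ((x, y), true) : ℕ) - 1)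
    (k2 : ∀ x y, k (x, y) - k (x - 1, y) = 1 - 2 * (W ((x, y), false) : ℕ))
    (c : ℤ × ℤ) (R : ℤ) (hk : ∀ s, sv_d s c ≤ R + 1 → h s = k s)
    (e : Edge) (he : sv_d e.1 c ≤ R) : sv_W h e = W e := by
  obtain ⟨⟨x, y⟩, b⟩ := e
  have e0 := hk (x, y) (by try dsimp only at he; omega)
  have e1 := hk (x, y - 1) (by
    simp only [sv_d] at *
    have := abs_sub_le (y - 1) y c.2
    have : |y - 1 - y| = 1 := by simp
    omega)
  have e2 := hk (x - 1, y) (by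
    simp only [sv_d] at *
    have := abs_sub_le (x - 1) x c.1
    have : |x - 1 - x| = 1 := by simp
    omega)
  have k1 := k1 x y
  have k2 := k2 x y
  cases b
  · have := (W ((x, y), false)).isLt
    apply Fin.ext
    simp only [sv_W, e0, e2, Bool.false_eq_true, if_false]
    split_ifs <;> simp <;> omega
  · have := (W ((x, y), true)).isLt
    apply Fin.ext
    simp only [sv_W, e0, e1, if_true]
    split_ifs <;> simp <;> omega

theorem sv_eDist (x y : ℤ × ℤ) : eDist x y ≤ (sv_d x y : ℤ) := by
  unfold eDist sv_d
  apply Real.sqrt_le_iff.2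
  push_cast
  have := abs_nonneg ((x.1 : ℝ) - y.1)
  have := abs_nonneg ((x.2 : ℝ) - y.2)
  refine ⟨by positivity, ?_⟩
  rw [← sq_abs ((x.1 : ℝ) - y.1), ← sq_abs ((x.2 : ℝ) - y.2)]
  nlinarith [mul_nonneg (abs_nonneg ((x.1 : ℝ) - y.1)) (abs_nonneg ((x.2 : ℝ) - y.2))]

/-- The six-vertex model is topologically mixing: for any two finite sets of
edges there is `M` such that any two admissible patterns, on `E₁` and on a
translate of `E₂` at Euclidean distance `≥ M` from `E₁`, jointly extend to a
globally admissible configuration. -/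
theorem sixVertex_mixing (E₁ E₂ : Set Edge) (h₁ : E₁.Finite) (h₂ : E₂.Finite) :
    ∃ M : ℝ, ∀ v : ℤ × ℤ,
      (∀ e₁ ∈ E₁, ∀ e₂ ∈ E₂, ∀ x ∈ edgeEnds e₁, ∀ y ∈ edgeEnds (edgeShift v e₂),
        M ≤ eDist x y) →
      ∀ W₁ W₂ : Edge → Fin 2, Adm6 W₁ → Adm6 W₂ →
        ∃ W, Adm6 W ∧ (∀ e ∈ E₁, W e = W₁ e) ∧
          (∀ e ∈ E₂, W (edgeShift v e) = W₂ (edgeShift v e)) := by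
  classical
  rcases E₁.eq_empty_or_nonempty with rfl | ⟨a, ha⟩
  · exact ⟨0, fun v _ W₁ W₂ _ H₂ => ⟨W₂, H₂, by simp, fun _ _ => rfl⟩⟩
  rcases E₂.eq_empty_or_nonempty with rfl | ⟨b, hb⟩
  · exact ⟨0, fun v _ W₁ W₂ H₁ _ => ⟨W₁, H₁, fun _ _ => rfl, by simp⟩⟩
  obtain ⟨R₁, hR₁⟩ := sv_bdd E₁ h₁
  obtain ⟨R₂, hR₂⟩ := sv_bdd E₂ h₂
  obtain ⟨R, hRa, hRb⟩ : ∃ R, R₁ ≤ R ∧ R₂ ≤ R := ⟨max R₁ R₂, le_max_left _ _, le_max_right _ _⟩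
  refine ⟨((6 * R + 10 : ℤ) : ℝ), fun v hv W₁ W₂ H₁ H₂ => ?_⟩
  have far := (hv a ha b hb a.1 (by simp [edgeEnds]) (edgeShift v b).1
    (by simp [edgeEnds])).trans (sv_eDist _ _)
  have far : 6 * R + 10 ≤ sv_d a.1 (edgeShift v b).1 := by exact_mod_cast far
  have tri : ∀ a b c, sv_d a c ≤ sv_d a b + sv_d b c := by
    intro a b c
    have := abs_sub_le a.1 b.1 c.1
    have := abs_sub_le a.2 b.2 c.2
    simp only [sv_d]; omega
  have symm : ∀ a b, sv_d a b = sv_d b a := by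
    intro a b
    simp only [sv_d, abs_sub_comm]
  have hA : ∀ e ∈ E₁, sv_d e.1 (0, 0) ≤ R := by
    intro e he
    have := hR₁ e he
    simp only [sv_d, sub_zero]; omega
  have hB : ∀ e ∈ E₂, sv_d (edgeShift v e).1 v ≤ R := by
    intro e he
    have := hR₂ e he
    simp only [sv_d, edgeShift, add_sub_cancel_right]; omega
  have hfar : 4 * R + 10 ≤ sv_d (0, 0) v := by
    have := hA a ha
    have := hB b hb
    have := tri a.1 (0, 0) (edgeShift v b).1
    have := tri (0, 0) v (edgeShift v b).1
    have := symm v (edgeShift v b).1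
    omega
  obtain ⟨k, kh, kp, k1, k2⟩ := sv_height W₁ H₁ (0, 0)
  obtain ⟨l, lh, lp, l1, l2⟩ := sv_height W₂ H₂ v
  have kpar := fun q => sv_par kh (0, 0) q (by rw [kp]; simp)
  have lpar := fun q => sv_par lh v q (by rw [lp]; omega)
  have R0 : 0 ≤ R := by
    have := hA a ha
    have : 0 ≤ sv_d a.1 (0, 0) := by unfold sv_d; positivity
    omega
  have disj : ∀ s, sv_d s v ≤ R + 1 → ¬ sv_d s (0, 0) ≤ R + 1 := by
    intro s h1 h2
    have := tri (0, 0) s v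
    have := symm s (0, 0)
    omega
  have cross : ∀ s t, sv_d s (0, 0) ≤ R + 1 → sv_d t v ≤ R + 1 → |k s - l t| ≤ sv_d s t := by
    intro s t hs ht
    have a1 := sv_lip kh s (0, 0)
    have a2 := sv_lip lh t v
    have := tri (0, 0) s v
    have := tri s t v
    have := symm s (0, 0)
    have kp' : k (0, 0) = 0 := by rw [kp]; simp
    have : l v = 0 ∨ l v = 1 := by rw [lp]; omega
    rw [abs_le] at *
    omega
  obtain ⟨h, hh, hf⟩ := sv_ext {s | sv_d s (0, 0) ≤ R + 1 ∨ sv_d s v ≤ R + 1}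
    ⟨(0, 0), Or.inl (by simp [sv_d]; omega)⟩
    (fun s => if sv_d s (0, 0) ≤ R + 1 then k s else l s)
    (by
      intro s hs t ht
      simp only [Set.mem_setOf_eq] at hs ht
      try dsimp only
      split_ifs with c1 c2 c2
      · exact (abs_le.1 (sv_lip kh s t)).2
      · exact (abs_le.1 (cross s t c1 (ht.resolve_left c2))).2
      · have := (abs_le.1 (cross t s c2 (hs.resolve_left c1))).1
        have := symm s t
        omega
      · exact (abs_le.1 (sv_lip lh s t)).2)
    (by
      intro s hs
      try dsimp only
      split_ifs
      · exact kpar s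
      · exact lpar s)
  refine ⟨sv_W h, sv_W_adm hh, ?_, ?_⟩
  · intro e he
    refine sv_W_eq k1 k2 (0, 0) R ?_ e (hA e he)
    intro s hs
    rw [hf s (Or.inl hs), if_pos hs]
  · intro e he
    refine sv_W_eq l1 l2 v R ?_ _ (hB e he)
    intro s hs
    rw [hf s (Or.inr hs), if_neg (disj s hs)]
end
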